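/- arXiv:1504.03891 — 7 statements merged into one kernel-verified Lean document; each statement's English description precedes it below -/
import Mathlib

section
/- Let ν be a probability measure on ℝ and let A, B : ℝ → ℝ be nondecreasing functions such that (A(λ) − A(μ))(B(λ) − B(μ)) = 0 for ν ⊗ ν-almost every (λ, μ) ∈ ℝ². Then either A is ν-almost everywhere equal to a constant, or B is ν-almost everywhere equal to a constant. -/
open MeasureTheory

/-- A real function is a.e. constant as soon as each of its sublevel sets is null or conull. -/
lemma exists_ae_eq_const_of_forall_ae_le_or_lt {α : Type*} [MeasurableSpace α]
    {ν : Measure α} {f : α → ℝ}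
    (h : ∀ a : ℝ, (∀ᵐ x ∂ν, f x ≤ a) ∨ ∀ᵐ x ∂ν, a < f x) :
    ∃ c : ℝ, ∀ᵐ x ∂ν, f x = c := by
  have := HasCountableSeparatingOn.range_Iic (X := ℝ) (s := Set.univ)
  refine Filter.exists_eventuallyEq_const_of_forall_separating (l := ae ν) (f := f)
    (· ∈ Set.range Set.Iic) ?_
  rintro _ ⟨a, rfl⟩
  simpa using h a

/-- If `{A ≤ a}` is contained in `{B ≤ b}`, the former is not null and the latter is not conull,
then `(A x - A y) * (B x - B y)` is nonzero on a set of pairs of positive measure. -/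
lemma not_ae_mul_sub_eq_zero_of_sublevel_subset {α : Type*} [MeasurableSpace α]
    {ν : Measure α} [SFinite ν] {A B : α → ℝ} {a b : ℝ}
    (hA : ¬ ∀ᵐ x ∂ν, a < A x) (hB : ¬ ∀ᵐ x ∂ν, B x ≤ b)
    (hAB : ∀ x, A x ≤ a → B x ≤ b) :
    ¬ ∀ᵐ p ∂(ν.prod ν), (A p.1 - A p.2) * (B p.1 - B p.2) = 0 := by
  intro h
  refine hA ?_
  filter_upwards [Measure.ae_ae_of_ae_prod h] with x hx
  by_contra! hxa
  refine hB ?_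
  filter_upwards [hx] with y hy
  by_contra! hyb
  have hya : a < A y := by
    by_contra! hya
    exact hyb.not_ge (hAB y hya)
  have hxb := hAB x hxa
  rcases mul_eq_zero.1 hy with h0 | h0 <;> linarith

/-- If `ν` is a probability measure on `ℝ` and `A`, `B` are nondecreasing real functions
with `(A(λ) − A(μ))(B(λ) − B(μ)) = 0` for `ν ⊗ ν`-a.e. `(λ, μ)`, then `A` is `ν`-a.e.
constant or `B` is `ν`-a.e. constant. -/
theorem monotone_ae_constant_of_product_vanishes
    (ν : Measure ℝ) [IsProbabilityMeasure ν]
    (A B : ℝ → ℝ) (hA : Monotone A) (hB : Monotone B)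
    (h : ∀ᵐ p ∂(ν.prod ν), (A p.1 - A p.2) * (B p.1 - B p.2) = 0) :
    (∃ c : ℝ, ∀ᵐ l ∂ν, A l = c) ∨ (∃ c : ℝ, ∀ᵐ l ∂ν, B l = c) := by
  by_contra hne
  rw [not_or] at hne
  obtain ⟨a, ha⟩ := not_forall.1 (mt exists_ae_eq_const_of_forall_ae_le_or_lt hne.1)
  obtain ⟨b, hb⟩ := not_forall.1 (mt exists_ae_eq_const_of_forall_ae_le_or_lt hne.2)
  rw [not_or] at ha hb
  have hUA : IsLowerSet {x | A x ≤ a} := fun _ _ hxy hx => (hA hxy).trans hx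
  have hUB : IsLowerSet {x | B x ≤ b} := fun _ _ hxy hx => (hB hxy).trans hx
  rcases hUA.total hUB with hsub | hsub
  · exact not_ae_mul_sub_eq_zero_of_sublevel_subset ha.2 hb.1 hsub h
  · exact not_ae_mul_sub_eq_zero_of_sublevel_subset hb.2 ha.1 hsub
      (h.mono fun _ hp => (mul_comm _ _).trans hp)
end

section
/- Let Ω ⊂ ℝ^d be bounded open, T > 0, Q_T = Ω × (0,T), and let 0 = t₀ < t₁ < … < t_n = T with Δt_{n,k} = t_k − t_{k−1}. Let π_m : ℝ^m → L^∞(Ω) be a linear map, ω ∈ L^∞(Ω), and P : C_c^∞(Ω) → ℝ^m a linear operator satisfying ∫_Ω ω · π_m(u) · (π_m(P φ) − φ) dx = 0 for every u ∈ ℝ^m and φ ∈ C_c^∞(Ω). For u = (u^k)_{0≤k≤n} ∈ (ℝ^m)^{n+1} define π_m^n u(·,t) = π_m u^k and δ_m^n u(·,t) = (π_m u^k − π_m u^{k−1})/Δt_{n,k} for t ∈ (t_{k−1}, t_k], and for time-dependent φ define (P^n φ)^k = P φ(·, t_{k−1}) for 1 ≤ k ≤ n, (P^n φ)^0 = P φ(·,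 0). Then for every φ ∈ C_c^∞(Ω × (0,T)) and every u ∈ (ℝ^m)^{n+1}: ∫∫_{Q_T} ( ω · δ_m^n u · π_m^n P^n φ + ω · π_m^n u · ∂_t φ ) dx dt = 0. -/
open MeasureTheory Set

/-- A smooth compactly supported test function with support inside `U`. -/
def IsTestFun {E : Type*} [NormedAddCommGroup E] [NormedSpace ℝ E]
    (U : Set E) (φ : E → ℝ) : Prop :=
  ContDiff ℝ (⊤ : ℕ∞) φ ∧ HasCompactSupport φ ∧ tsupport φ ⊆ U

/-- A time slice of a test function on a space-time cylinder is a test function. -/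
theorem IsTestFun.slice {E : Type*} [NormedAddCommGroup E] [NormedSpace ℝ E]
    {U : Set E} {J : Set ℝ} {φ : E × ℝ → ℝ} (hφ : IsTestFun (U ×ˢ J) φ) (s : ℝ) :
    IsTestFun U (fun y => φ (y, s)) := by
  obtain ⟨hsmooth, hcompact, hsupp⟩ := hφ
  have hsub : tsupport (fun y => φ (y, s)) ⊆ (fun y => (y, s)) ⁻¹' tsupport φ :=
    tsupport_comp_subset_preimage φ (by fun_prop : Continuous fun y : E => (y, s))
  refine ⟨hsmooth.comp (contDiff_id.prodMk contDiff_const), ?_, fun y hy => (hsupp (hsub hy)).1⟩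
  exact (hcompact.image continuous_fst).of_isClosed_subset (isClosed_tsupport _)
    fun y hy => ⟨(y, s), hsub hy, rfl⟩

theorem IsTestFun.apply_eq_zero {E : Type*} [NormedAddCommGroup E] [NormedSpace ℝ E]
    {U : Set E} {φ : E → ℝ} (hφ : IsTestFun U φ) {p : E} (hp : p ∉ U) : φ p = 0 :=
  image_eq_zero_of_notMem_tsupport fun h => hp (hφ.2.2 h)

theorem IsTestFun.exists_bound {E : Type*} [NormedAddCommGroup E] [NormedSpace ℝ E]
    {U : Set E} {φ : E → ℝ} (hφ : IsTestFun U φ) : ∃ M, ∀ x, |φ x| ≤ M :=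
  hφ.1.continuous.bounded_above_of_compact_support hφ.2.1

theorem exists_bound_mul {X : Type*} {f g : X → ℝ} (hf : ∃ M, ∀ x, |f x| ≤ M)
    (hg : ∃ M, ∀ x, |g x| ≤ M) : ∃ M, ∀ x, |f x * g x| ≤ M := by
  obtain ⟨M, hM⟩ := hf
  obtain ⟨N, hN⟩ := hg
  refine ⟨M * N, fun x => ?_⟩
  rw [abs_mul]
  exact mul_le_mul (hM x) (hN x) (abs_nonneg _) ((abs_nonneg _).trans (hM x))

theorem Measurable.integrable_of_exists_bound {X : Type*} [MeasurableSpace X] {μ : Measure X}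
    [IsFiniteMeasure μ] {f : X → ℝ} (hf : Measurable f) (hb : ∃ M, ∀ x, |f x| ≤ M) :
    Integrable f μ := by
  obtain ⟨M, hM⟩ := hb
  exact Integrable.of_bound hf.aestronglyMeasurable M (Filter.Eventually.of_forall hM)

theorem hasDerivAt_snd_of_contDiff {E : Type*} [NormedAddCommGroup E] [NormedSpace ℝ E]
    {φ : E × ℝ → ℝ} (hφ : ContDiff ℝ 1 φ) (x : E) (s : ℝ) :
    HasDerivAt (fun r => φ (x, r)) (fderiv ℝ φ (x, s) (0, 1)) s :=
  ((hφ.differentiable one_ne_zero (x, s)).hasFDerivAt).comp_hasDerivAt s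
    ((hasDerivAt_const s x).prodMk (hasDerivAt_id s))

theorem continuous_deriv_snd {E : Type*} [NormedAddCommGroup E] [NormedSpace ℝ E]
    {φ : E × ℝ → ℝ} (hφ : ContDiff ℝ 1 φ) :
    Continuous fun p : E × ℝ => deriv (fun r => φ (p.1, r)) p.2 := by
  simp_rw [(hasDerivAt_snd_of_contDiff hφ _ _).deriv]
  exact (hφ.continuous_fderiv one_ne_zero).clm_apply continuous_const

theorem exists_bound_deriv_snd {E : Type*} [NormedAddCommGroup E] [NormedSpace ℝ E]
    {φ : E × ℝ → ℝ} (hφ : ContDiff ℝ 1 φ) (hcompact : HasCompactSupport φ) :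
    ∃ M, ∀ p : E × ℝ, |deriv (fun r => φ (p.1, r)) p.2| ≤ M := by
  simp_rw [(hasDerivAt_snd_of_contDiff hφ _ _).deriv]
  exact ((hφ.continuous_fderiv one_ne_zero).clm_apply
    continuous_const).bounded_above_of_compact_support (hcompact.fderiv_apply ℝ (0, 1))

section TimeIntegration

variable {E : Type*} [NormedAddCommGroup E] [NormedSpace ℝ E] [SecondCountableTopology E]
  [MeasurableSpace E] [BorelSpace E] {μ : Measure E} [IsFiniteMeasure μ] {c : E → ℝ}
  {φ : E × ℝ → ℝ}

theorem integrable_mul_deriv_snd (hc : Measurable c) (hcb : ∃ M, ∀ x, |c x| ≤ M)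
    (hφ : ContDiff ℝ 1 φ) (hcompact : HasCompactSupport φ)
    (ν : Measure ℝ) [IsFiniteMeasure ν] :
    Integrable (fun p : ℝ × E => c p.2 * deriv (fun r => φ (p.2, r)) p.1) (ν.prod μ) := by
  refine Measurable.integrable_of_exists_bound ?_ ?_
  · exact (hc.comp measurable_snd).mul
      ((continuous_deriv_snd hφ).comp continuous_swap).measurable
  · obtain ⟨M, hM⟩ := hcb
    obtain ⟨N, hN⟩ := exists_bound_deriv_snd hφ hcompact
    exact exists_bound_mul ⟨M, fun p : ℝ × E => hM p.2⟩ ⟨N, fun p => hN p.swap⟩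

theorem integral_Ioc_integral_mul_deriv_snd (hc : Measurable c) (hcb : ∃ M, ∀ x, |c x| ≤ M)
    (hφ : ContDiff ℝ 1 φ) (hcompact : HasCompactSupport φ) {a b : ℝ} (hab : a ≤ b) :
    ∫ s in Ioc a b, ∫ x, c x * deriv (fun r => φ (x, r)) s ∂μ =
      ∫ x, c x * (φ (x, b) - φ (x, a)) ∂μ := by
  rw [integral_integral_swap (integrable_mul_deriv_snd hc hcb hφ hcompact _)]
  congr 1 with x
  rw [integral_const_mul, ← intervalIntegral.integral_of_le hab]
  congr 1
  refine intervalIntegral.integral_deriv_eq_sub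
    (fun s _ => (hasDerivAt_snd_of_contDiff hφ x s).differentiableAt) ?_
  exact ((continuous_deriv_snd hφ).comp
    (by fun_prop : Continuous fun s : ℝ => (x, s))).intervalIntegrable a b

end TimeIntegration

theorem Fin.sum_univ_sub_castSucc {n : ℕ} (F : Fin (n + 1) → ℝ) :
    ∑ k : Fin n, (F k.succ - F k.castSucc) = F (Fin.last n) - F 0 := by
  rw [Finset.sum_sub_distrib]
  linarith [Fin.sum_univ_succ F, Fin.sum_univ_castSucc F]

/-- Discrete summation-by-parts consistency of the one-step (backward Euler) discrete
time differentiation operator: for every test function `φ ∈ C_c^∞(Ω × (0,T))` and every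
vector of discrete unknowns `u ∈ (ℝ^m)^{n+1}`,
`∫∫_{Q_T} ( ω δ_m^n u · π_m^n P^n φ + ω π_m^n u · ∂_t φ ) = 0`,
the piecewise-constant-in-time reconstructions being unfolded as sums over the time
slabs `(t_{k−1}, t_k]`. -/
theorem discrete_summation_by_parts
    (d m n : ℕ) (hn : 0 < n)
    (Ω : Set (Fin d → ℝ)) (hΩo : IsOpen Ω) (hΩb : Bornology.IsBounded Ω)
    (T : ℝ) (hT : 0 < T)
    (t : Fin (n+1) → ℝ) (ht0 : t 0 = 0) (htT : t (Fin.last n) = T) (htmono : StrictMono t)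
    (πm : (Fin m → ℝ) →ₗ[ℝ] ((Fin d → ℝ) → ℝ))
    (hπmeas : ∀ w : Fin m → ℝ, Measurable (πm w))
    (hπbdd : ∀ w : Fin m → ℝ, ∃ M : ℝ, ∀ x, |πm w x| ≤ M)
    (ω : (Fin d → ℝ) → ℝ) (hωmeas : Measurable ω) (hωbdd : ∃ M : ℝ, ∀ x, |ω x| ≤ M)
    (P : ((Fin d → ℝ) → ℝ) →ₗ[ℝ] (Fin m → ℝ))
    (hproj : ∀ (w : Fin m → ℝ) (g : (Fin d → ℝ) → ℝ), IsTestFun Ω g →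
      ∫ x in Ω, ω x * πm w x * (πm (P g) x - g x) = 0)
    (φ : (Fin d → ℝ) × ℝ → ℝ) (hφ : IsTestFun (Ω ×ˢ Ioo 0 T) φ)
    (u : Fin (n+1) → Fin m → ℝ) :
    ∑ k : Fin n, ∫ s in Ioc (t k.castSucc) (t k.succ), ∫ x in Ω,
        (ω x * ((πm (u k.succ) x - πm (u k.castSucc) x) / (t k.succ - t k.castSucc))
            * πm (P (fun y => φ (y, t k.castSucc))) x
          + ω x * πm (u k.succ) x * deriv (fun r => φ (x, r)) s) = 0 := by
  have : IsFiniteMeasure (volume.restrict Ω) :=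
    isFiniteMeasure_restrict.2 hΩb.measure_lt_top.ne
  have hφ1 : ContDiff ℝ 1 φ := hφ.1.of_le (by exact_mod_cast le_top)
  have hslice (s : ℝ) := hφ.slice s
  have hcm (w) : Measurable fun x => ω x * πm w x := hωmeas.mul (hπmeas w)
  have hcb (w) : ∃ M, ∀ x, |ω x * πm w x| ≤ M := exists_bound_mul hωbdd (hπbdd w)
  have hci (w s) : Integrable (fun x => ω x * πm w x * φ (x, s)) (volume.restrict Ω) :=
    ((hcm w).mul (hslice s).1.continuous.measurable).integrable_of_exists_bound
      (exists_bound_mul (hcb w) (hslice s).exists_bound)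
  have hpi (w v) : Integrable (fun x => ω x * πm w x * πm v x) (volume.restrict Ω) :=
    ((hcm w).mul (hπmeas v)).integrable_of_exists_bound (exists_bound_mul (hcb w) (hπbdd v))
  have hPφ (w s) : ∫ x in Ω, ω x * πm w x * πm (P fun y => φ (y, s)) x =
      ∫ x in Ω, ω x * πm w x * φ (x, s) := by
    rw [← sub_eq_zero, ← integral_sub (hpi _ _) (hci _ _), ← hproj w _ (hslice s)]
    simp_rw [mul_sub]
  set F : Fin (n + 1) → ℝ := fun k => ∫ x in Ω, ω x * πm (u k) x * φ (x, t k) with hF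
  have hF0 : F 0 = 0 := by
    simp [hF, ht0, hφ.apply_eq_zero]
  have hFn : F (Fin.last n) = 0 := by
    simp [hF, htT, hφ.apply_eq_zero]
  trans ∑ k : Fin n, (F k.succ - F k.castSucc)
  swap
  · rw [Fin.sum_univ_sub_castSucc, hF0, hFn, sub_zero]
  refine Finset.sum_congr rfl fun k _ => ?_
  have hlt : t k.castSucc < t k.succ := htmono k.castSucc_lt_succ
  have hΔ : t k.succ - t k.castSucc ≠ 0 := (sub_pos.2 hlt).ne'
  have hint := integrable_mul_deriv_snd (μ := volume.restrict Ω) (hcm (u k.succ))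
    (hcb (u k.succ)) hφ1 hφ.2.1 (volume.restrict (Ioc (t k.castSucc) (t k.succ)))
  have hinner (s : ℝ) : ∫ x in Ω,
        (ω x * ((πm (u k.succ) x - πm (u k.castSucc) x) / (t k.succ - t k.castSucc))
            * πm (P (fun y => φ (y, t k.castSucc))) x
          + ω x * πm (u k.succ) x * deriv (fun r => φ (x, r)) s) =
      (t k.succ - t k.castSucc)⁻¹ *
          (∫ x in Ω, ω x * πm (u k.succ - u k.castSucc) x * φ (x, t k.castSucc)) +
        ∫ x in Ω, ω x * πm (u k.succ) x * deriv (fun r => φ (x, r)) s := by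
    rw [← hPφ, ← integral_const_mul, ← integral_add ((hpi _ _).const_mul _)]
    · congr 1 with x
      simp only [map_sub, Pi.sub_apply]
      ring
    · refine ((hcm _).mul ((continuous_deriv_snd hφ1).comp
        (by fun_prop : Continuous fun x : Fin d → ℝ => (x, s))).measurable
        ).integrable_of_exists_bound (exists_bound_mul (hcb _) ?_)
      obtain ⟨M, hM⟩ := exists_bound_deriv_snd hφ1 hφ.2.1
      exact ⟨M, fun x => hM (x, s)⟩
  simp_rw [hinner]
  rw [integral_add (integrable_const _) hint.integral_prod_left,
    integral_Ioc_integral_mul_deriv_snd (hcm _) (hcb _) hφ1 hφ.2.1 hlt.le, setIntegral_const,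
    Real.volume_real_Ioc_of_le hlt.le, smul_eq_mul, mul_inv_cancel_left₀ hΔ,
    ← integral_add (hci _ _), hF, ← integral_sub (hci _ _) (hci _ _)]
  · congr 1 with x
    simp only [map_sub, Pi.sub_apply]
    ring
  · simp_rw [mul_sub]
    exact (hci _ _).sub (hci _ _)
end

section
/- Let n ≥ 1 and Δt₁, …, Δt_n > 0. Let T_n = diag(1, Δt₁, …, Δt_n) ∈ M_{n+1}(ℝ), and let D_n ∈ M_{n+1}(ℝ) be the lower bidiagonal matrix with 1 on the diagonal and −1 on the subdiagonal. Let M̂_n ∈ M_{n+1}(ℝ) be lower triangular and invertible, with first row equal to (1, 0, …, 0) and with each of its other rows summing to zero (Σ_{ℓ=0}^n (M̂_n)_{k,ℓ} = 0 for 1 ≤ k ≤ n). Then there exists a unique invertible lower triangular matrix A_n ∈ M_n(ℝ) such that T_n M̂_n D_n^{−1} is the block-diagonal matrix with a 1 in the top-left entry, A_n as the remaining n × n diagonal block, and zeros elsewhere in the first row and first column. -/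
/-- The lower bidiagonal difference matrix `D_n ∈ M_{n+1}(ℝ)` with `1` on the diagonal
and `−1` on the subdiagonal. -/
def Dmat (n : ℕ) : Matrix (Fin (n+1)) (Fin (n+1)) ℝ :=
  Matrix.of fun i j => if i = j then 1 else if i.1 = j.1 + 1 then -1 else 0

/-- The diagonal matrix `T_n = diag(1, Δt₁, …, Δt_n) ∈ M_{n+1}(ℝ)`. -/
def Tmat (n : ℕ) (Δt : Fin n → ℝ) : Matrix (Fin (n+1)) (Fin (n+1)) ℝ :=
  Matrix.diagonal (Fin.cons 1 Δt)

/-- The block-diagonal matrix in `M_{n+1}(ℝ)` with top-left entry `1`, the matrix `A`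
as the remaining `n × n` diagonal block, and zeros elsewhere in the first row/column. -/
def lowerBlock (n : ℕ) (A : Matrix (Fin n) (Fin n) ℝ) :
    Matrix (Fin (n+1)) (Fin (n+1)) ℝ :=
  Matrix.of (Fin.cons (Fin.cons 1 0) (fun i => Fin.cons 0 (A i)))

open Matrix

theorem Dmat_blockTriangular (n : ℕ) : (Dmat n).BlockTriangular OrderDual.toDual := by
  intro i j hij
  have h : i < j := hij
  have h1 : i ≠ j := h.ne
  have h2 : ¬ i.1 = j.1 + 1 := by have := Fin.lt_def.1 h; omega
  simp [Dmat, h1, h2]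

theorem det_Dmat (n : ℕ) : (Dmat n).det = 1 := by
  rw [det_of_isLowerTriangular _ (Dmat_blockTriangular n)]
  simp [Dmat]

theorem Dmat_mulVec_one (n : ℕ) : Dmat n *ᵥ 1 = Pi.single 0 1 := by
  ext i
  simp only [mulVec, dotProduct, Pi.one_apply, mul_one]
  induction i using Fin.cases with
  | zero => simp [Dmat]
  | succ i =>
    rw [← Finset.sum_subset (Finset.subset_univ {i.succ, i.castSucc})]
    · rw [Finset.sum_pair (Fin.castSucc_lt_succ).ne']
      simp [Dmat, (Fin.castSucc_lt_succ (i := i)).ne']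
    · intro j _ hj
      simp only [Finset.mem_insert, Finset.mem_singleton, not_or, Fin.ext_iff, Fin.val_succ,
        Fin.val_castSucc] at hj
      have h1 : ¬ i.succ = j := by rw [Fin.ext_iff, Fin.val_succ]; omega
      have h2 : ¬ i.succ.1 = j.1 + 1 := by rw [Fin.val_succ]; omega
      simp only [Dmat, of_apply, if_neg h1, if_neg h2]

theorem Dmat_inv_mulVec_single (n : ℕ) : (Dmat n)⁻¹ *ᵥ Pi.single 0 1 = 1 := by
  rw [← Dmat_mulVec_one, mulVec_mulVec, nonsing_inv_mul _ (by simp [det_Dmat]), one_mulVec]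

theorem det_lowerBlock (n : ℕ) (A : Matrix (Fin n) (Fin n) ℝ) :
    (lowerBlock n A).det = A.det := by
  rw [det_succ_row_zero, Fin.sum_univ_succ]
  have h : (lowerBlock n A).submatrix Fin.succ (Fin.succAbove 0) = A := by
    ext i j
    simp [lowerBlock]
  rw [h]
  simp [lowerBlock]

theorem lowerBlock_injective (n : ℕ) : Function.Injective (lowerBlock n) := by
  intro A B h
  ext i j
  simpa [lowerBlock] using congrFun₂ h i.succ j.succ

theorem eq_lowerBlock_submatrix {n : ℕ} {P : Matrix (Fin (n+1)) (Fin (n+1)) ℝ}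
    (hrow : ∀ j : Fin n, P 0 j.succ = 0) (hcol : P *ᵥ Pi.single 0 1 = Pi.single 0 1) :
    P = lowerBlock n (P.submatrix Fin.succ Fin.succ) := by
  have hcol' : ∀ i, P i 0 = (Pi.single 0 1 : Fin (n+1) → ℝ) i := fun i => by
    simpa using congrFun hcol i
  ext i j
  induction i using Fin.cases <;> induction j using Fin.cases <;>
    simp [lowerBlock, hrow, hcol']

/-- Reduction of a multistep time differentiation matrix: if `M̂_n ∈ M_{n+1}(ℝ)` is
lower triangular and invertible, has first row `(1, 0, …, 0)` and all other rows summing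
to zero, then there is a unique invertible lower triangular `A_n ∈ M_n(ℝ)` with
`T_n M̂_n D_n⁻¹ = blockdiag(1, A_n)`. -/
theorem exists_unique_multistep_block_matrix
    (n : ℕ) (hn : 1 ≤ n) (Δt : Fin n → ℝ) (hΔt : ∀ k, 0 < Δt k)
    (Mh : Matrix (Fin (n+1)) (Fin (n+1)) ℝ)
    (hMlow : ∀ i j : Fin (n+1), (i : ℕ) < (j : ℕ) → Mh i j = 0)
    (hMinv : IsUnit Mh.det)
    (hMrow0 : ∀ j : Fin (n+1), Mh 0 j = if j = 0 then 1 else 0)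
    (hMsum : ∀ k : Fin (n+1), k ≠ 0 → ∑ l, Mh k l = 0) :
    ∃! A : Matrix (Fin n) (Fin n) ℝ,
      (∀ i j : Fin n, (i : ℕ) < (j : ℕ) → A i j = 0) ∧ IsUnit A.det ∧
      Tmat n Δt * Mh * (Dmat n)⁻¹ = lowerBlock n A := by
  have hD : IsUnit (Dmat n).det := by simp [det_Dmat]
  set P := Tmat n Δt * Mh * (Dmat n)⁻¹ with hP
  have hlow : P.BlockTriangular OrderDual.toDual := by
    have : Invertible (Dmat n) := invertibleOfIsUnitDet _ hD
    exact ((blockTriangular_diagonal _).mul fun i j h => hMlow i j h).mul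
      (blockTriangular_inv_of_blockTriangular (Dmat_blockTriangular n))
  have hcol : P *ᵥ Pi.single 0 1 = Pi.single 0 1 := by
    rw [hP, ← mulVec_mulVec, Dmat_inv_mulVec_single, ← mulVec_mulVec]
    have hM : Mh *ᵥ 1 = Pi.single 0 1 := by
      ext k
      simp only [mulVec, dotProduct, Pi.one_apply, mul_one]
      by_cases hk : k = 0
      · subst hk
        simp [hMrow0]
      · simp [hMsum k hk, hk]
    rw [hM, Tmat, diagonal_mulVec_single]
    simp
  have hPblock := eq_lowerBlock_submatrix (fun j => hlow (Fin.succ_pos j)) hcol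
  have hdet : IsUnit P.det := by
    rw [hP, det_mul, det_mul]
    refine (IsUnit.mul ?_ hMinv).mul (isUnit_nonsing_inv_det _ hD)
    rw [Tmat, det_diagonal, Fin.prod_univ_succ]
    simpa using (Finset.prod_pos fun k _ => hΔt k).ne'
  refine ⟨P.submatrix Fin.succ Fin.succ, ⟨fun i j h => hlow (Fin.succ_lt_succ_iff.2 h), ?_,
    hPblock⟩, fun B hB => lowerBlock_injective n (hB.2.2.symm.trans hPblock)⟩
  rwa [← det_lowerBlock, ← hPblock]
end

section
/- Let n ≥ 1 and let A_n ∈ M_n(ℝ) be the lower bidiagonal matrix with (A_n)_{1,1} = 1, (A_n)_{k,k} = 3/2 for 2 ≤ k ≤ n, (A_n)_{k,k−1} = −1/2 for 2 ≤ k ≤ n, and all other entries zero. Then A_n is invertible and ‖A_n^{−1}‖₁ = (3/2)(1 − 3^{−n}); in particular ‖A_n^{−1}‖₁ ≤ 3/2. -/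
/-- The BDF2 matrix `A_n ∈ M_n(ℝ)` (indices starting at `0` here): first diagonal entry
`1`, remaining diagonal entries `3/2`, subdiagonal entries `−1/2`, all other entries `0`. -/
noncomputable def bdf2Mat (n : ℕ) : Matrix (Fin n) (Fin n) ℝ :=
  Matrix.of fun i j =>
    if i = j then (if i.1 = 0 then 1 else 3/2)
    else if i.1 = j.1 + 1 then -(1/2) else 0

/-- The entries of the inverse of the BDF2 matrix, indexed by natural numbers. -/
noncomputable def bdf2InvEntry (i j : ℕ) : ℝ :=
  if j ≤ i then (if j = 0 then 1 else 2/3) * (1/3) ^ (i - j) else 0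

lemma bdf2InvEntry_nonneg (i j : ℕ) : 0 ≤ bdf2InvEntry i j := by
  unfold bdf2InvEntry
  split_ifs <;> positivity

lemma bdf2InvEntry_succ_relation (m j : ℕ) :
    3/2 * bdf2InvEntry (m + 1) j - 1/2 * bdf2InvEntry m j = if m + 1 = j then 1 else 0 := by
  unfold bdf2InvEntry
  rcases lt_trichotomy (m + 1) j with h | h | h
  · rw [if_neg (by omega), if_neg (by omega), if_neg (by omega)]
    norm_num
  · subst h
    norm_num
  · rw [if_pos h.le, if_pos (Nat.le_of_lt_succ h), if_neg h.ne',
      show m + 1 - j = m - j + 1 by omega, pow_succ]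
    ring

lemma bdf2Mat_mul_inv (n : ℕ) :
    bdf2Mat n * Matrix.of (fun i j : Fin n => bdf2InvEntry i j) = 1 := by
  ext ⟨i, hi⟩ ⟨j, hj⟩
  rw [Matrix.mul_apply, Matrix.one_apply]
  cases i with
  | zero =>
    rw [Finset.sum_eq_single (⟨0, hi⟩ : Fin n)]
    · cases j <;> simp [bdf2Mat, bdf2InvEntry]
    · intro k _ hk
      simp [bdf2Mat, hk.symm]
    · simp
  | succ m =>
    rw [Finset.sum_eq_add (⟨m + 1, hi⟩ : Fin n) (⟨m, by omega⟩ : Fin n) (by simp)]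
    · have h := bdf2InvEntry_succ_relation m j
      simp only [bdf2Mat, Matrix.of_apply, Fin.mk.injEq]
      rw [← h]
      simp
      ring
    · rintro ⟨k, hk⟩ _ ⟨h1, h2⟩
      simp only [ne_eq, Fin.mk.injEq] at h1 h2
      simp only [bdf2Mat, Matrix.of_apply, Fin.mk.injEq]
      rw [if_neg (by omega), if_neg (by omega), zero_mul]
    · simp
    · simp

lemma sum_bdf2InvEntry (n j : ℕ) (hj : j ≤ n) :
    ∑ i ∈ Finset.range n, bdf2InvEntry i j =
      (if j = 0 then 1 else 2/3) * (3/2 * (1 - (1/3) ^ (n - j))) := by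
  induction n, hj using Nat.le_induction with
  | base =>
    rw [Finset.sum_eq_zero]
    · simp
    · intro i hi
      exact if_neg (by simpa using hi)
  | succ n hn ih =>
    rw [Finset.sum_range_succ, ih, bdf2InvEntry, if_pos hn,
      show n + 1 - j = n - j + 1 by omega, pow_succ]
    ring

lemma sum_abs_bdf2Mat_inv (n : ℕ) (j : Fin n) :
    ∑ i, |(bdf2Mat n)⁻¹ i j| =
      (if j.1 = 0 then 1 else 2/3) * (3/2 * (1 - (1/3) ^ (n - j.1))) := by
  rw [Matrix.inv_eq_right_inv (bdf2Mat_mul_inv n), ← sum_bdf2InvEntry n j j.2.le,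
    Finset.sum_range]
  exact Finset.sum_congr rfl fun i _ => abs_of_nonneg (bdf2InvEntry_nonneg i j)

/-- The BDF2 matrix is invertible and the matrix `1`-norm
`‖A_n⁻¹‖₁ = max_j Σ_i |(A_n⁻¹)_{ij}|` equals `(3/2)(1 − 3^{−n})`; in particular it is
at most `3/2`. -/
theorem bdf2Mat_inv_norm (n : ℕ) (hn : 1 ≤ n) :
    IsUnit (bdf2Mat n).det ∧
    Finset.univ.sup' (Finset.univ_nonempty_iff.mpr (Fin.pos_iff_nonempty.mp hn))
        (fun j => ∑ i, |(bdf2Mat n)⁻¹ i j|) = (3/2) * (1 - (3:ℝ) ^ (-(n:ℤ))) ∧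
    Finset.univ.sup' (Finset.univ_nonempty_iff.mpr (Fin.pos_iff_nonempty.mp hn))
        (fun j => ∑ i, |(bdf2Mat n)⁻¹ i j|) ≤ 3/2 := by
  have hpow : (3:ℝ) ^ (-(n:ℤ)) = (1/3) ^ n := by
    rw [zpow_neg, zpow_natCast, one_div, inv_pow]
  have key : Finset.univ.sup' (Finset.univ_nonempty_iff.mpr (Fin.pos_iff_nonempty.mp hn))
      (fun j => ∑ i, |(bdf2Mat n)⁻¹ i j|) = (3/2) * (1 - (3:ℝ) ^ (-(n:ℤ))) := by
    simp only [sum_abs_bdf2Mat_inv, hpow]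
    apply le_antisymm
    · refine Finset.sup'_le _ _ fun j _ => ?_
      split_ifs with h
      · simp [h]
      · have h1 : (1/3 : ℝ) ^ n ≤ (1/3) ^ (n - j.1) :=
          pow_le_pow_of_le_one (by norm_num) (by norm_num) (Nat.sub_le _ _)
        have h2 : (1/3 : ℝ) ^ n ≤ 1 := pow_le_one₀ (by norm_num) (by norm_num)
        linarith
    · refine le_trans ?_ (Finset.le_sup' _ (Finset.mem_univ (⟨0, hn⟩ : Fin n)))
      simp
  refine ⟨?_, key, ?_⟩
  · exact Matrix.isUnit_det_of_right_inverse (bdf2Mat_mul_inv n)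
  · rw [key, hpow]
    have : (0:ℝ) ≤ (1/3) ^ n := by positivity
    linarith
end

section
/- Let q > 1 and define ψ(u) = |u|^{q−1} u and φ(u) = (2√q/(q+1)) |u|^{(q−1)/2} u for u ∈ ℝ. Then for all a, b ∈ ℝ: |ψ(a) − ψ(b)| ≤ √q · max(|a|, |b|)^{(q−1)/2} · |φ(a) − φ(b)|. -/
/-- `ψ(u) = |u|^{q−1} u`. -/
noncomputable def psiPM (q u : ℝ) : ℝ := |u| ^ (q - 1) * u

/-- The Kirchhoff-type transform `φ(u) = (2√q/(q+1)) |u|^{(q−1)/2} u`. -/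
noncomputable def phiPM (q u : ℝ) : ℝ := (2 * Real.sqrt q / (q + 1)) * (|u| ^ ((q - 1) / 2) * u)

/-- The signed power `u ↦ |u| ^ r * u` is differentiable everywhere for `r > 0`. -/
theorem hasDerivAt_abs_rpow_mul_self {r : ℝ} (hr : 0 < r) (s : ℝ) :
    HasDerivAt (fun u : ℝ => |u| ^ r * u) ((r + 1) * |s| ^ r) s := by
  rcases eq_or_ne s 0 with rfl | hs
  · rw [hasDerivAt_iff_tendsto_slope]
    have hc : Continuous fun u : ℝ => |u| ^ r :=
      continuous_abs.rpow_const fun _ => Or.inr hr.le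
    have ht := (hc.tendsto 0).mono_left (nhdsWithin_le_nhds (s := {0}ᶜ))
    simp only [abs_zero, Real.zero_rpow hr.ne', mul_zero] at ht ⊢
    refine ht.congr' ?_
    filter_upwards [self_mem_nhdsWithin] with u hu
    have hu : u ≠ 0 := hu
    simp [slope_def_field, hu]
  · have habs : |s| ≠ 0 := abs_ne_zero.mpr hs
    have h := ((hasDerivAt_abs hs).rpow_const (p := r) (Or.inl habs)).mul (hasDerivAt_id s)
    refine h.congr_deriv ?_
    have hsign : (SignType.sign s : ℝ) * s = |s| := sign_mul_self s
    have hpow : |s| ^ (r - 1) * |s| = |s| ^ r := by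
      rw [Real.rpow_sub_one habs, div_mul_cancel₀ _ habs]
    simp only [id_eq]
    linear_combination (r * |s| ^ (r - 1)) * hsign + r * hpow

theorem hasDerivAt_psiPM {q : ℝ} (hq : 1 < q) (s : ℝ) :
    HasDerivAt (psiPM q) (q * |s| ^ (q - 1)) s := by
  refine (hasDerivAt_abs_rpow_mul_self (sub_pos.mpr hq) s).congr_deriv ?_
  rw [sub_add_cancel]

theorem hasDerivAt_phiPM {q : ℝ} (hq : 1 < q) (s : ℝ) :
    HasDerivAt (phiPM q) (√q * |s| ^ ((q - 1) / 2)) s := by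
  have h := (hasDerivAt_abs_rpow_mul_self (r := (q - 1) / 2) (by linarith) s).const_mul
    (2 * √q / (q + 1))
  refine h.congr_deriv ?_
  have : q + 1 ≠ 0 := by linarith
  field_simp
  ring

theorem monotone_psiPM {q : ℝ} (hq : 1 < q) : Monotone (psiPM q) :=
  monotone_of_hasDerivAt_nonneg (hasDerivAt_psiPM hq) fun s => by
    simp only [Pi.zero_apply]
    positivity

theorem monotone_phiPM {q : ℝ} (hq : 1 < q) : Monotone (phiPM q) :=
  monotone_of_hasDerivAt_nonneg (hasDerivAt_phiPM hq) fun s => by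
    simp only [Pi.zero_apply]
    positivity

/-- On `[-M, M]` the increments of `ψ` are controlled by those of `φ`. -/
theorem monotoneOn_phiPM_sub_psiPM {q : ℝ} (hq : 1 < q) (M : ℝ) :
    MonotoneOn (fun u => √q * M ^ ((q - 1) / 2) * phiPM q u - psiPM q u) (Set.Icc (-M) M) := by
  have hd (s : ℝ) := ((hasDerivAt_phiPM hq s).const_mul (√q * M ^ ((q - 1) / 2))).sub
    (hasDerivAt_psiPM hq s)
  refine monotoneOn_of_hasDerivWithinAt_nonneg (convex_Icc _ _)
    (fun s _ => (hd s).continuousAt.continuousWithinAt)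
    (fun s _ => (hd s).hasDerivWithinAt) fun s hs => ?_
  have hsM : |s| ≤ M := abs_le.mpr (Set.mem_Icc.mp (interior_subset hs))
  have hpow : |s| ^ ((q - 1) / 2) ≤ M ^ ((q - 1) / 2) :=
    Real.rpow_le_rpow (abs_nonneg s) hsM (by linarith)
  have hsq : |s| ^ (q - 1) = |s| ^ ((q - 1) / 2) * |s| ^ ((q - 1) / 2) := by
    rw [← Real.rpow_add_of_nonneg (abs_nonneg s) (by linarith) (by linarith), add_halves]
  have hqq : √q * √q = q := Real.mul_self_sqrt (by linarith)
  have hle : q * |s| ^ ((q - 1) / 2) * |s| ^ ((q - 1) / 2) ≤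
      q * M ^ ((q - 1) / 2) * |s| ^ ((q - 1) / 2) := by gcongr
  rw [hsq]
  linear_combination hle - M ^ ((q - 1) / 2) * |s| ^ ((q - 1) / 2) * hqq

/-- For `q > 1`, `ψ(u) = |u|^{q−1}u` and `φ(u) = (2√q/(q+1))|u|^{(q−1)/2}u`, one has
`|ψ(a) − ψ(b)| ≤ √q · max(|a|,|b|)^{(q−1)/2} · |φ(a) − φ(b)|` for all real `a`, `b`. -/
theorem abs_psi_diff_le (q : ℝ) (hq : 1 < q) (a b : ℝ) :
    |psiPM q a - psiPM q b| ≤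
      Real.sqrt q * (max |a| |b|) ^ ((q - 1) / 2) * |phiPM q a - phiPM q b| := by
  wlog hab : b ≤ a generalizing a b
  · rw [abs_sub_comm, max_comm, abs_sub_comm (phiPM q a)]
    exact this b a (le_of_not_ge hab)
  rw [abs_of_nonneg (sub_nonneg.mpr (monotone_psiPM hq hab)),
    abs_of_nonneg (sub_nonneg.mpr (monotone_phiPM hq hab))]
  have h := monotoneOn_phiPM_sub_psiPM hq (max |a| |b|)
    (abs_le.mp (le_max_right |a| |b|)) (abs_le.mp (le_max_left |a| |b|)) hab
  simp only at h
  linarith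
end

section
/- Let 𝒯 be a finite nonempty set with cell measures m_K > 0 (K ∈ 𝒯), a symmetric neighbour relation (L ∈ N_K ⟺ K ∈ N_L, K ∉ N_K) and transmissibilities τ_{KL} = τ_{LK} ≥ 0 for L ∈ N_K. Let q > 1, ψ(u) = |u|^{q−1}u, φ(u) = (2√q/(q+1))|u|^{(q−1)/2}u, Δt > 0 and n ≥ 2. Suppose (u^k)_{0≤k≤n} ⊂ ℝ^𝒯 satisfies, for all K ∈ 𝒯 and all 2 ≤ k ≤ n, the BDF2 step: ((3/2)u_K^k − 2u_K^{k−1} + (1/2)u_K^{k−2}) m_K/Δt + Σ_{L∈N_K} τ_{KL}(ψ(u_K^k) − ψ(u_L^k)) = 0. Then for every ℓ ∈ {2, …, n}: (1/4) Σ_{K∈𝒯} m_K ( (u_K^ℓ)² + (2u_K^ℓ − u_K^{ℓ−1})² ) + Σ_{k=2}^ℓ Δt Σ_{edges {K,L}} τ_{KL} (φ(u_K^k) − φ(u_L^k))² ≤ (1/4) Σ_{K∈𝒯} m_K ( (u_K¹)² + (2u_K¹ − u_K⁰)² ). -/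
/-- The map `x ↦ |x| ^ p * x` is differentiable everywhere for `p > 0`. -/
theorem hasDerivAt_abs_rpow_mul_self_s18 {p : ℝ} (hp : 0 < p) (x : ℝ) :
    HasDerivAt (fun y : ℝ => |y| ^ p * y) ((p + 1) * |x| ^ p) x := by
  rcases eq_or_ne x 0 with rfl | hx
  · have hcont : Continuous fun y : ℝ => |y| ^ p :=
      continuous_abs.rpow_const fun _ => Or.inr hp.le
    rw [hasDerivAt_iff_tendsto_slope]
    have hlim : Filter.Tendsto (fun y : ℝ => |y| ^ p) (nhdsWithin 0 {0}ᶜ)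
        (nhds ((p + 1) * |(0 : ℝ)| ^ p)) := by
      have h := (hcont.tendsto 0).mono_left (nhdsWithin_le_nhds (s := {0}ᶜ))
      simpa [Real.zero_rpow hp.ne'] using h
    refine hlim.congr' ?_
    filter_upwards [self_mem_nhdsWithin] with y hy
    have hy0 : y ≠ 0 := hy
    simp [slope_def_field, hy0]
  · have habs : |x| ≠ 0 := abs_ne_zero.mpr hx
    have h := ((hasDerivAt_abs hx).rpow_const (p := p) (Or.inl habs)).mul (hasDerivAt_id x)
    refine h.congr_deriv ?_
    have hsign : (SignType.sign x : ℝ) * x = |x| := sign_mul_self x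
    have hpow : |x| ^ (p - 1) * |x| = |x| ^ p := by
      rw [← Real.rpow_add_one habs, sub_add_cancel]
    simp only [id]
    linear_combination p * |x| ^ (p - 1) * hsign + p * hpow

/-- If `f' = (g')²` everywhere, then `(g a - g b)² ≤ (f a - f b) (a - b)`. -/
theorem sq_sub_le_mul_sub_of_hasDerivAt_sq {f g g' : ℝ → ℝ}
    (hf : ∀ x, HasDerivAt f (g' x ^ 2) x) (hg : ∀ x, HasDerivAt g (g' x) x) (a b : ℝ) :
    (g a - g b) ^ 2 ≤ (f a - f b) * (a - b) := by
  wlog hab : b ≤ a generalizing a b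
  · linarith [this b a (le_of_not_ge hab)]
  rcases hab.eq_or_lt with rfl | hlt
  · simp
  have hpos : 0 < a - b := sub_pos.mpr hlt
  have hmono (c : ℝ) : Monotone fun x => f x - 2 * c * g x + c ^ 2 * x := by
    refine monotone_of_hasDerivAt_nonneg (f' := fun x => (g' x - c) ^ 2) (fun x => ?_)
      fun x => sq_nonneg _
    refine (((hf x).sub ((hg x).const_mul (2 * c))).add
      ((hasDerivAt_id x).const_mul (c ^ 2))).congr_deriv ?_
    ring
  have h := hmono ((g a - g b) / (a - b)) hab
  simp only at h
  have hc : (g a - g b) / (a - b) * (a - b) = g a - g b := div_mul_cancel₀ _ hpos.ne'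
  generalize (g a - g b) / (a - b) = c at h hc
  have hle : c * (g a - g b) ≤ f a - f b := by
    linear_combination h + c * hc
  calc (g a - g b) ^ 2 = c * (g a - g b) * (a - b) := by
        linear_combination -(g a - g b) * hc
    _ ≤ (f a - f b) * (a - b) := mul_le_mul_of_nonneg_right hle hpos.le

theorem sq_phiPM_sub_le {q : ℝ} (hq : 1 < q) (a b : ℝ) :
    (phiPM q a - phiPM q b) ^ 2 ≤ (psiPM q a - psiPM q b) * (a - b) := by
  refine sq_sub_le_mul_sub_of_hasDerivAt_sq
    (g' := fun x => Real.sqrt q * |x| ^ ((q - 1) / 2)) (fun x => ?_) (fun x => ?_) a b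
  · refine (hasDerivAt_abs_rpow_mul_self_s18 (p := q - 1) (by linarith) x).congr_deriv ?_
    rw [mul_pow, Real.sq_sqrt (by linarith), ← Real.rpow_mul_natCast (abs_nonneg x)]
    norm_num
  · refine ((hasDerivAt_abs_rpow_mul_self_s18 (p := (q - 1) / 2) (by linarith) x).const_mul
      (2 * Real.sqrt q / (q + 1))).congr_deriv ?_
    have : q + 1 ≠ 0 := by linarith
    field_simp
    ring

/-- Discrete integration by parts on a finite graph with symmetric weights. -/
theorem sum_neighbors_sub_mul_eq_half {ι : Type*} [Fintype ι] {N : ι → Finset ι}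
    (hN : ∀ K L, L ∈ N K ↔ K ∈ N L) {τ : ι → ι → ℝ} (hτ : ∀ K L, τ K L = τ L K)
    (f v : ι → ℝ) :
    ∑ K, ∑ L ∈ N K, τ K L * (f K - f L) * v K =
      (1 / 2) * ∑ K, ∑ L ∈ N K, τ K L * ((f K - f L) * (v K - v L)) := by
  have hswap : ∑ K, ∑ L ∈ N K, τ K L * (f K - f L) * v K =
      ∑ K, ∑ L ∈ N K, τ K L * (f L - f K) * v L := by
    rw [Finset.sum_comm' (t' := Finset.univ) (s' := N) (by simpa using hN)]
    exact Finset.sum_congr rfl fun K _ => Finset.sum_congr rfl fun L _ => by rw [hτ]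
  have hsplit : ∑ K, ∑ L ∈ N K, τ K L * ((f K - f L) * (v K - v L)) =
      ∑ K, ∑ L ∈ N K, τ K L * (f K - f L) * v K +
        ∑ K, ∑ L ∈ N K, τ K L * (f L - f K) * v L := by
    simp only [← Finset.sum_add_distrib]
    exact Finset.sum_congr rfl fun K _ => Finset.sum_congr rfl fun L _ => by ring
  rw [hsplit, ← hswap]
  ring

/-- Energy decay over a single BDF2 step, from `(c, b)` to `(b, a)`. -/
theorem bdf2_single_step_energy_le {ι : Type*} [Fintype ι]
    {mK : ι → ℝ} (hm : ∀ K, 0 < mK K)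
    {N : ι → Finset ι} (hN : ∀ K L, L ∈ N K ↔ K ∈ N L)
    {τ : ι → ι → ℝ} (hτ : ∀ K L, τ K L = τ L K) (hτpos : ∀ K L, L ∈ N K → 0 ≤ τ K L)
    {q : ℝ} (hq : 1 < q) {Δt : ℝ} (hΔt : 0 < Δt) {a b c : ι → ℝ}
    (hstep : ∀ K, ((3/2) * a K - 2 * b K + (1/2) * c K) * mK K / Δt
      + ∑ L ∈ N K, τ K L * (psiPM q (a K) - psiPM q (a L)) = 0) :
    (1/4) * (∑ K, mK K * ((a K)^2 + (2 * a K - b K)^2))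
        + Δt * ((1/2) * ∑ K, ∑ L ∈ N K, τ K L * (phiPM q (a K) - phiPM q (a L))^2)
      ≤ (1/4) * (∑ K, mK K * ((b K)^2 + (2 * b K - c K)^2)) := by
  have hdiss : (1/2) * ∑ K, ∑ L ∈ N K, τ K L * (phiPM q (a K) - phiPM q (a L))^2 ≤
      ∑ K, ∑ L ∈ N K, τ K L * (psiPM q (a K) - psiPM q (a L)) * a K := by
    rw [sum_neighbors_sub_mul_eq_half hN hτ (fun K => psiPM q (a K)) a]
    gcongr with K _ L hL
    · exact hτpos K L hL
    · exact sq_phiPM_sub_le hq _ _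
  refine (add_le_add_right (mul_le_mul_of_nonneg_left hdiss hΔt.le) _).trans ?_
  simp only [Finset.mul_sum Finset.univ, ← Finset.sum_add_distrib]
  refine Finset.sum_le_sum fun K _ => ?_
  rw [← Finset.sum_mul]
  have h := hstep K
  generalize ∑ L ∈ N K, τ K L * (psiPM q (a K) - psiPM q (a L)) = S at h ⊢
  have hS : Δt * S = -(((3/2) * a K - 2 * b K + (1/2) * c K) * mK K) := by
    field_simp at h
    linarith
  rw [← mul_assoc Δt, hS]
  linarith [mul_nonneg (hm K).le (sq_nonneg (a K - 2 * b K + c K))]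

/-- Energy estimate for the BDF2 steps of the two-point flux finite volume scheme for
the porous medium equation.  Sums over edges `{K,L}` (each unordered pair counted once)
are written as half of the corresponding symmetric double sums. -/
theorem bdf2_steps_energy_estimate
    (ι : Type*) [Fintype ι] [Nonempty ι]
    (mK : ι → ℝ) (hm : ∀ K, 0 < mK K)
    (N : ι → Finset ι) (hNsym : ∀ K L, L ∈ N K ↔ K ∈ N L) (hNirr : ∀ K, K ∉ N K)
    (τ : ι → ι → ℝ) (hτsym : ∀ K L, τ K L = τ L K) (hτpos : ∀ K L, L ∈ N K → 0 ≤ τ K L)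
    (q : ℝ) (hq : 1 < q) (Δt : ℝ) (hΔt : 0 < Δt) (n : ℕ) (hn : 2 ≤ n)
    (u : ℕ → ι → ℝ)
    (hscheme : ∀ K, ∀ k, 2 ≤ k → k ≤ n →
      ((3/2) * u k K - 2 * u (k-1) K + (1/2) * u (k-2) K) * mK K / Δt
        + ∑ L ∈ N K, τ K L * (psiPM q (u k K) - psiPM q (u k L)) = 0) :
    ∀ l, 2 ≤ l → l ≤ n →
      (1/4) * (∑ K, mK K * ((u l K)^2 + (2 * u l K - u (l-1) K)^2))
        + ∑ k ∈ Finset.Icc 2 l, Δt *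
            ((1/2) * ∑ K, ∑ L ∈ N K, τ K L * (phiPM q (u k K) - phiPM q (u k L))^2)
      ≤ (1/4) * (∑ K, mK K * ((u 1 K)^2 + (2 * u 1 K - u 0 K)^2)) := by
  intro l hl
  induction l, hl using Nat.le_induction with
  | base =>
    intro _
    simpa using bdf2_single_step_energy_le hm hNsym hτsym hτpos hq hΔt
      (hscheme · 2 le_rfl hn)
  | succ l hl ih =>
    intro hln
    have hstep := bdf2_single_step_energy_le hm hNsym hτsym hτpos hq hΔt
      (hscheme · (l + 1) (by omega) hln)
    rw [show l + 1 - 2 = l - 1 by omega] at hstep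
    simp only [Nat.add_sub_cancel] at hstep ⊢
    rw [Finset.sum_Icc_succ_top (by omega)]
    linarith [ih (by omega)]
end

section
/- Let 𝒯 be a finite nonempty set with cell measures m_K > 0 (K ∈ 𝒯), a symmetric neighbour relation (L ∈ N_K ⟺ K ∈ N_L, K ∉ N_K) and transmissibilities τ_{KL} = τ_{LK} ≥ 0 for L ∈ N_K. Let q > 1, ψ(u) = |u|^{q−1}u, Δt > 0, n ≥ 1 and u⁰ ∈ ℝ^𝒯. Then there exists a unique family (u^k)_{1≤k≤n} ⊂ ℝ^𝒯 solving the scheme: for all K ∈ 𝒯, (u_K¹ − u_K⁰) m_K/Δt + Σ_{L∈N_K} τ_{KL}(ψ(u_K¹) − ψ(u_L¹)) = 0, and for all 2 ≤ k ≤ n, ((3/2)u_K^k − 2u_K^{k−1} + (1/2)u_K^{k−2}) m_K/Δt + Σ_{L∈N_K} τ_{KL}(ψ(u_K^k) − ψ(u_L^k)) = 0. -/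
theorem continuous_psiPM {q : ℝ} (hq : 1 < q) : Continuous (psiPM q) :=
  (continuous_abs.rpow_const fun _ => Or.inr (sub_pos.2 hq).le).mul continuous_id

theorem strictMono_psiPM {q : ℝ} (hq : 1 < q) : StrictMono (psiPM q) := by
  refine strictMono_of_odd_strictMonoOn_nonneg (fun x => by simp [psiPM]) ?_
  intro x (hx : 0 ≤ x) y (hy : 0 ≤ y) hxy
  simp only [psiPM, abs_of_nonneg hx, abs_of_nonneg hy]
  exact mul_lt_mul'' (Real.rpow_lt_rpow hx hxy (sub_pos.2 hq)) hxy
    (Real.rpow_nonneg hx _) hx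

section NonlinearSystem

variable {ι : Type*} [Fintype ι] {a : ι → ℝ} {N : ι → Finset ι} {τ : ι → ι → ℝ} {ψ : ℝ → ℝ}

/-- Discrete comparison principle: it is tested at a cell where `ψ (x K) - ψ (y K)` is maximal. -/
theorem le_of_flux_system_eq (ha : ∀ K, 0 < a K)
    (hτ : ∀ K L, L ∈ N K → 0 ≤ τ K L) (hψ : StrictMono ψ) {x y : ι → ℝ}
    (hxy : ∀ K, a K * x K + ∑ L ∈ N K, τ K L * (ψ (x K) - ψ (x L)) =
      a K * y K + ∑ L ∈ N K, τ K L * (ψ (y K) - ψ (y L))) : x ≤ y := by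
  intro J
  have : Nonempty ι := ⟨J⟩
  obtain ⟨K, hK⟩ := Finite.exists_max fun K => ψ (x K) - ψ (y K)
  have hsum : ∑ L ∈ N K, τ K L * (ψ (y K) - ψ (y L)) ≤
      ∑ L ∈ N K, τ K L * (ψ (x K) - ψ (x L)) :=
    Finset.sum_le_sum fun L hL =>
      mul_le_mul_of_nonneg_left (by linarith [hK L]) (hτ K L hL)
  have hle : x K ≤ y K := le_of_mul_le_mul_left (by linarith [hxy K]) (ha K)
  exact hψ.le_iff_le.1 (by linarith [hK J, hψ.monotone hle])

/-- A solution is a fixed point of the monotone map that solves the equation in each cell with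
the values in the neighbouring cells frozen. -/
theorem exists_flux_system_eq (ha : ∀ K, 0 < a K)
    (hτ : ∀ K L, L ∈ N K → 0 ≤ τ K L) (hψ : StrictMono ψ) (hc : Continuous ψ) (b : ι → ℝ) :
    ∃ x : ι → ℝ, ∀ K, a K * x K + ∑ L ∈ N K, τ K L * (ψ (x K) - ψ (x L)) = b K := by
  obtain ⟨M, hM0, hM⟩ : ∃ M : ℝ, 0 ≤ M ∧ ∀ K, |b K| ≤ a K * M := by
    refine ⟨∑ K, |b K| / a K, Finset.sum_nonneg fun K _ => by have := ha K; positivity, ?_⟩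
    intro K
    rw [← div_le_iff₀' (ha K)]
    exact Finset.single_le_sum (f := fun K => |b K| / a K)
      (fun K _ => by have := ha K; positivity) (Finset.mem_univ K)
  have : Fact (-M ≤ M) := ⟨by linarith⟩
  have hcell : ∀ (w : ι → Set.Icc (-M) M) (K : ι), ∃ s : Set.Icc (-M) M,
      a K * s + ∑ L ∈ N K, τ K L * (ψ s - ψ (w L)) = b K := by
    intro w K
    have hcont : Continuous fun s : ℝ => a K * s + ∑ L ∈ N K, τ K L * (ψ s - ψ (w L)) := by
      fun_prop
    have hlow : ∑ L ∈ N K, τ K L * (ψ (-M) - ψ (w L)) ≤ 0 :=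
      Finset.sum_nonpos fun L hL => mul_nonpos_of_nonneg_of_nonpos (hτ K L hL)
        (sub_nonpos.2 (hψ.monotone (w L).2.1))
    have hupp : 0 ≤ ∑ L ∈ N K, τ K L * (ψ M - ψ (w L)) :=
      Finset.sum_nonneg fun L hL => mul_nonneg (hτ K L hL)
        (sub_nonneg.2 (hψ.monotone (w L).2.2))
    have hb := abs_le.1 (hM K)
    obtain ⟨s, hs, hsb⟩ := intermediate_value_Icc this.out hcont.continuousOn
      (show b K ∈ Set.Icc _ _ from ⟨by linarith, by linarith⟩)
    exact ⟨⟨s, hs⟩, hsb⟩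
  choose F hF using hcell
  have hmono : Monotone F := by
    intro v w hvw K
    by_contra hlt
    have hlt : F w K < F v K := not_le.1 hlt
    have hlt' : (F w K : ℝ) < F v K := hlt
    have hsum : ∑ L ∈ N K, τ K L * (ψ (F w K) - ψ (w L)) ≤
        ∑ L ∈ N K, τ K L * (ψ (F v K) - ψ (v L)) :=
      Finset.sum_le_sum fun L hL => mul_le_mul_of_nonneg_left
        (sub_le_sub (hψ.monotone hlt'.le) (hψ.monotone (hvw L))) (hτ K L hL)
    linarith [hF v K, hF w K, mul_lt_mul_of_pos_left hlt' (ha K)]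
  let x := OrderHom.lfp ⟨F, hmono⟩
  have hx : F x = x := OrderHom.map_lfp ⟨F, hmono⟩
  refine ⟨fun K => x K, fun K => ?_⟩
  have := hF x K
  rwa [hx] at this

/-- Unique solvability of one implicit time step. -/
theorem existsUnique_implicit_step {m : ι → ℝ} (hm : ∀ K, 0 < m K)
    (hτ : ∀ K L, L ∈ N K → 0 ≤ τ K L) (hψ : StrictMono ψ) (hc : Continuous ψ)
    {Δt : ℝ} (hΔt : 0 < Δt) {c : ℝ} (hc0 : 0 < c) (b : ι → ℝ) :
    ∃! x : ι → ℝ, ∀ K,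
      (c * x K + b K) * m K / Δt + ∑ L ∈ N K, τ K L * (ψ (x K) - ψ (x L)) = 0 := by
  have ha : ∀ K, 0 < c * m K / Δt := fun K => by have := hm K; positivity
  have hsplit : ∀ (x : ι → ℝ) K,
      (c * x K + b K) * m K / Δt = c * m K / Δt * x K + b K * m K / Δt := fun x K => by ring
  obtain ⟨x, hx⟩ := exists_flux_system_eq ha hτ hψ hc fun K => -(b K * m K / Δt)
  refine ⟨x, fun K => by linarith [hx K, hsplit x K], fun y hy => ?_⟩
  have hy' : ∀ K, c * m K / Δt * y K + ∑ L ∈ N K, τ K L * (ψ (y K) - ψ (y L)) =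
      c * m K / Δt * x K + ∑ L ∈ N K, τ K L * (ψ (x K) - ψ (x L)) := fun K => by
    linarith [hx K, hy K, hsplit y K]
  exact le_antisymm (le_of_flux_system_eq ha hτ hψ hy')
    (le_of_flux_system_eq ha hτ hψ fun K => (hy' K).symm)

end NonlinearSystem

theorem exists_seq_two_step {X : Type*} (x₀ : X) (f : X → X) (g : X → X → X) :
    ∃ v : ℕ → X, v 0 = x₀ ∧ v 1 = f x₀ ∧ ∀ k, v (k + 2) = g (v (k + 1)) (v k) :=
  let p : ℕ → X × X := fun k => Nat.rec (x₀, f x₀) (fun _ z => (z.2, g z.2 z.1)) k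
  ⟨fun k => (p k).1, rfl, rfl, fun _ => rfl⟩

/-- Existence and uniqueness of the discrete solution of the fully implicit two-point
flux finite-volume scheme with BDF2 time stepping (implicit Euler for the first step)
for the porous medium equation, at the purely algebraic level.
The solution is encoded as a vector `u : Fin (n+1) → ι → ℝ` with `u 0` the given
initial datum. -/
theorem bdf2_scheme_exists_unique
    (ι : Type*) [Fintype ι] [Nonempty ι]
    (mK : ι → ℝ) (hm : ∀ K, 0 < mK K)
    (N : ι → Finset ι) (hNsym : ∀ K L, L ∈ N K ↔ K ∈ N L) (hNirr : ∀ K, K ∉ N K)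
    (τ : ι → ι → ℝ) (hτsym : ∀ K L, τ K L = τ L K) (hτpos : ∀ K L, L ∈ N K → 0 ≤ τ K L)
    (q : ℝ) (hq : 1 < q) (Δt : ℝ) (hΔt : 0 < Δt) (n : ℕ) (hn : 1 ≤ n)
    (u0 : ι → ℝ) :
    ∃! u : Fin (n+1) → ι → ℝ,
      u 0 = u0 ∧
      (∀ K, (u ⟨1, by omega⟩ K - u 0 K) * mK K / Δt
          + ∑ L ∈ N K, τ K L * (psiPM q (u ⟨1, by omega⟩ K) - psiPM q (u ⟨1, by omega⟩ L)) = 0) ∧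
      (∀ k : Fin (n+1), 2 ≤ k.1 → ∀ K,
        ((3/2) * u k K - 2 * u ⟨k.1 - 1, by omega⟩ K + (1/2) * u ⟨k.1 - 2, by omega⟩ K)
            * mK K / Δt
          + ∑ L ∈ N K, τ K L * (psiPM q (u k K) - psiPM q (u k L)) = 0) := by
  have hstep := fun {c : ℝ} (hc : 0 < c) (b : ι → ℝ) =>
    existsUnique_implicit_step hm hτpos (strictMono_psiPM hq) (continuous_psiPM hq) hΔt hc b
  have heuler : ∀ y : ι → ℝ, ∃! x : ι → ℝ, ∀ K, (x K - y K) * mK K / Δt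
      + ∑ L ∈ N K, τ K L * (psiPM q (x K) - psiPM q (x L)) = 0 := fun y => by
    simpa only [one_mul, Pi.neg_apply, ← sub_eq_add_neg] using hstep one_pos (-y)
  have hbdf : ∀ y z : ι → ℝ, ∃! x : ι → ℝ, ∀ K,
      ((3/2) * x K - 2 * y K + (1/2) * z K) * mK K / Δt
        + ∑ L ∈ N K, τ K L * (psiPM q (x K) - psiPM q (x L)) = 0 := fun y z => by
    simpa only [neg_mul, ← add_assoc, ← sub_eq_add_neg] using
      hstep (c := 3/2) (by norm_num) fun K => -2 * y K + (1/2) * z K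
  choose f hf hf_unique using heuler
  choose g hg hg_unique using hbdf
  obtain ⟨v, hv0, hv1, hv⟩ := exists_seq_two_step u0 f g
  refine ⟨fun k => v k, ⟨hv0, ?_, ?_⟩, ?_⟩
  · simpa only [Fin.val_zero, hv0, hv1] using hf u0
  · rintro ⟨k, hk⟩ hk2
    obtain ⟨j, rfl⟩ := Nat.exists_eq_add_of_le' hk2
    simpa only [hv j, Nat.add_sub_cancel, show j + 2 - 1 = j + 1 from rfl] using
      hg (v (j + 1)) (v j)
  · rintro u ⟨hu0, hu1, hu⟩
    have hu_eq : ∀ k (hk : k < n + 1), u ⟨k, hk⟩ = v k := by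
      intro k
      induction k using Nat.strong_induction_on with
      | _ k ih =>
        intro hk
        match k with
        | 0 => exact hu0.trans hv0.symm
        | 1 =>
          rw [hu0] at hu1
          exact (hf_unique u0 _ hu1).trans hv1.symm
        | j + 2 =>
          rw [hv j, ← ih (j + 1) (by omega) (by omega), ← ih j (by omega) (by omega)]
          exact hg_unique _ _ _ (hu ⟨j + 2, hk⟩ (by simp))
    exact funext fun k => hu_eq k k.2
end
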